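/- The object generating function of the updown category of binary rooted trees is Σ_{n≥0} (C_n/2^n) t^n = (1 − √(1 − 2t))/t, where C_n is the n-th Catalan number; equivalently, for each n, Σ over isomorphism classes R of binary rooted trees with n internal vertices of 2^n/|Aut(R)| equals C_n. -/

import Mathlib

/-- Planar binary rooted trees: each internal vertex has exactly two (ordered) daughters. -/
inductive PBT : Type
  | leaf : PBT
  | node : PBT → PBT → PBT

namespace PBT

/-- Number of leaves (terminal vertices). -/
def nLeaves : PBT → ℕ
  | leaf => 1
  | node a b => a.nLeaves + b.nLeaves

/-- Number of internal (non-terminal) vertices. -/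
def internals : PBT → ℕ
  | leaf => 0
  | node a b => a.internals + b.internals + 1

/-- Number of internal vertices strictly above a given leaf. -/
def depth : (t : PBT) → Fin t.nLeaves → ℕ
  | leaf, _ => 0
  | node a b, i =>
    if h : (i : ℕ) < a.nLeaves then a.depth ⟨i, h⟩ + 1
    else b.depth ⟨(i : ℕ) - a.nLeaves, by
      have hi := i.isLt; simp only [nLeaves] at hi; omega⟩ + 1

/-- The leaf metric: `dist t i j` is the number of internal vertices contained
in the shortest path from leaf `i` to leaf `j`. -/
def dist : (t : PBT) → Fin t.nLeaves → Fin t.nLeaves → ℕ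
  | leaf, _, _ => 0
  | node a b, i, j =>
    if hi : (i : ℕ) < a.nLeaves then
      if hj : (j : ℕ) < a.nLeaves then a.dist ⟨i, hi⟩ ⟨j, hj⟩
      else a.depth ⟨i, hi⟩ + b.depth ⟨(j : ℕ) - a.nLeaves, by
        have h := j.isLt; simp only [nLeaves] at h; omega⟩ + 1
    else
      if hj : (j : ℕ) < a.nLeaves then
        b.depth ⟨(i : ℕ) - a.nLeaves, by
          have h := i.isLt; simp only [nLeaves] at h; omega⟩ + a.depth ⟨j, hj⟩ + 1
      else b.dist ⟨(i : ℕ) - a.nLeaves, by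
          have h := i.isLt; simp only [nLeaves] at h; omega⟩
        ⟨(j : ℕ) - a.nLeaves, by
          have h := j.isLt; simp only [nLeaves] at h; omega⟩

end PBT

/-- Abstract isomorphism of binary rooted trees: generated by swapping the two
subtrees at internal vertices. -/
inductive PBTEquiv : PBT → PBT → Prop
  | leaf : PBTEquiv .leaf .leaf
  | node {a b a' b'} : PBTEquiv a a' → PBTEquiv b b' → PBTEquiv (.node a b) (.node a' b')
  | swap {a b a' b'} : PBTEquiv a b' → PBTEquiv b a' → PBTEquiv (.node a b) (.node a' b')

/-- Isomorphism classes of binary rooted trees. -/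
def PBTClass := Quot PBTEquiv

/-- The order of the automorphism group of a binary rooted tree: bijections of the
leaf set preserving the leaf metric. -/
noncomputable def pbtAut (t : PBT) : ℕ :=
  Nat.card {σ : Equiv.Perm (Fin t.nLeaves) // ∀ i j, t.dist (σ i) (σ j) = t.dist i j}

open Classical in
/-- The coefficients `a_n = Σ_{R with n internal vertices} 1/|Aut(R)|` of the object
generating function of the updown category of binary rooted trees. -/
noncomputable def pbtCoeff (n : ℕ) : ℚ :=
  ∑ᶠ R : PBTClass, if (Quot.out R).internals = n then ((pbtAut (Quot.out R) : ℚ))⁻¹ else 0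

/-- The object generating function of the updown category of binary rooted trees. -/
noncomputable def pbtO : PowerSeries ℚ := PowerSeries.mk pbtCoeff

namespace PBT

/-- Structural leaf type. -/
def L : PBT → Type
  | leaf => Unit
  | node a b => L a ⊕ L b

/-- Structural depth. -/
def dp : (t : PBT) → L t → ℕ
  | leaf, _ => 0
  | node a _, Sum.inl i => dp a i + 1
  | node _ b, Sum.inr i => dp b i + 1

/-- Structural distance. -/
def ds : (t : PBT) → L t → L t → ℕ
  | leaf, _, _ => 0
  | node a _, Sum.inl i, Sum.inl j => ds a i j
  | node a b, Sum.inl i, Sum.inr j => dp a i + dp b j + 1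
  | node a b, Sum.inr i, Sum.inl j => dp b i + dp a j + 1
  | node _ b, Sum.inr i, Sum.inr j => ds b i j

/-- Comparison of leaf types. -/
def eL : (t : PBT) → L t ≃ Fin t.nLeaves
  | leaf => (finOneEquiv).symm
  | node a b => (Equiv.sumCongr (eL a) (eL b)).trans finSumFinEquiv

theorem eL_inl (a b : PBT) (i : L a) : ((eL (node a b) (Sum.inl i) : Fin _) : ℕ) = eL a i := rfl

theorem eL_inr (a b : PBT) (i : L b) :
    ((eL (node a b) (Sum.inr i) : Fin _) : ℕ) = a.nLeaves + eL b i := rfl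

theorem depth_eL (t : PBT) (i : L t) : t.depth (eL t i) = dp t i := by
  induction t with
  | leaf => rfl
  | node a b iha ihb =>
    rcases i with i | i
    · rw [depth, dif_pos (by rw [eL_inl]; exact Fin.isLt _)]
      simp only [eL_inl, Fin.eta, iha, dp]
    · rw [depth, dif_neg (by rw [eL_inr]; omega)]
      simp only [eL_inr, Nat.add_sub_cancel_left, Fin.eta, ihb, dp]

theorem dist_eL (t : PBT) (i j : L t) : t.dist (eL t i) (eL t j) = ds t i j := by
  induction t with
  | leaf => rfl
  | node a b iha ihb =>
    rcases i with i | i <;> rcases j with j | j <;>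
      simp [dist, eL_inl, eL_inr, ds, iha, ihb, depth_eL]

instance fintypeL (t : PBT) : Fintype (L t) := Fintype.ofEquiv _ (eL t).symm

theorem nLeaves_eq (t : PBT) : t.nLeaves = t.internals + 1 := by
  induction t with
  | leaf => rfl
  | node a b iha ihb => simp only [nLeaves, internals, iha, ihb]; omega

instance nonemptyL (t : PBT) : Nonempty (L t) :=
  ⟨(eL t).symm ⟨0, by rw [nLeaves_eq]; omega⟩⟩

theorem sum_node {a b : PBT} (f : L (node a b) → ℚ) :
    ∑ x, f x = ∑ i : L a, f (Sum.inl i) + ∑ j : L b, f (Sum.inr j) := by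
  refine Eq.trans ?_ (Fintype.sum_sum_type (α₁ := L a) (α₂ := L b) f)
  exact @Fintype.sum_equiv (L (node a b)) (L a ⊕ L b) ℚ (fintypeL _) _ _
    (Equiv.refl (L a ⊕ L b)) f f (fun _ => rfl)

theorem sum_leaf (f : L leaf → ℚ) : ∑ x, f x = f () := by
  refine Eq.trans ?_ (Fintype.sum_unique (ι := Unit) f)
  exact Fintype.sum_equiv (Equiv.refl Unit) f f (fun _ => rfl)

theorem kraft (t : PBT) : ∑ i : L t, (1/2 : ℚ) ^ dp t i = 1 := by
  induction t with
  | leaf => rw [sum_leaf]; simp [dp]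
  | node a b iha ihb =>
    rw [sum_node]
    simp only [dp, pow_succ, ← Finset.sum_mul, iha, ihb]
    norm_num

theorem sum_ds (t : PBT) (i : L t) : ∑ j : L t, (1/2 : ℚ) ^ ds t i j = 2 - (1/2) ^ dp t i := by
  induction t with
  | leaf => rw [sum_leaf]; simp only [ds, dp]; norm_num
  | node a b iha ihb =>
    rw [sum_node]
    rcases i with i | i
    · simp only [ds, dp, pow_succ, pow_add, ← Finset.sum_mul, ← Finset.mul_sum, iha, kraft]
      ring
    · simp only [ds, dp, pow_succ, pow_add, ← Finset.sum_mul, ← Finset.mul_sum, ihb, kraft]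
      ring

/-- Isometries. -/
def Iso (s t : PBT) : Type := {e : L s ≃ L t // ∀ i j, ds t (e i) (e j) = ds s i j}

theorem Iso.dp {s t : PBT} (e : Iso s t) (i : L s) : dp t (e.1 i) = dp s i := by
  have h1 := sum_ds t (e.1 i)
  rw [← Equiv.sum_comp e.1] at h1
  simp only [e.2] at h1
  rw [sum_ds] at h1
  have h2 : (1/2 : ℚ) ^ PBT.dp t (e.1 i) = (1/2) ^ PBT.dp s i := by linarith
  exact pow_right_injective₀ (by norm_num) (by norm_num) h2

theorem ds_le (t : PBT) (i j : L t) : ds t i j ≤ dp t i + dp t j := by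
  induction t with
  | leaf => simp [ds]
  | node a b iha ihb =>
    rcases i with i | i <;> rcases j with j | j <;> simp only [ds, dp]
    · have := iha i j; omega
    · omega
    · omega
    · have := ihb i j; omega

/-- Side of the root. -/
def side {a b : PBT} : L (node a b) → Bool
  | Sum.inl _ => true
  | Sum.inr _ => false

theorem side_iff {a b : PBT} (x y : L (node a b)) :
    side x ≠ side y ↔ ds (node a b) x y + 1 = dp (node a b) x + dp (node a b) y := by
  rcases x with i | i <;> rcases y with j | j <;> simp only [ds, dp, side]
  · have := ds_le a i j; simp; omega
  · simp; omega
  · simp; omega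
  · have := ds_le b i j; simp; omega

theorem Iso.side {a b c d : PBT} (e : Iso (node a b) (node c d)) (x y : L (node a b)) :
    PBT.side (e.1 x) = PBT.side (e.1 y) ↔ PBT.side x = PBT.side y := by
  rw [← not_iff_not]
  have := side_iff (e.1 x) (e.1 y)
  rw [e.2, e.dp, e.dp, ← side_iff] at this
  exact this

def Iso.refl (s : PBT) : Iso s s := ⟨Equiv.refl _, fun _ _ => rfl⟩

def Iso.symm {s t : PBT} (e : Iso s t) : Iso t s :=
  ⟨e.1.symm, fun i j => by rw [← e.2]; simp⟩

def Iso.trans {s t u : PBT} (e : Iso s t) (f : Iso t u) : Iso s u :=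
  ⟨e.1.trans f.1, fun i j => by simp [e.2, f.2]⟩

def Iso.swap (a b : PBT) : Iso (node a b) (node b a) :=
  ⟨Equiv.sumComm (L a) (L b), fun i j => by
    rcases i with i | i <;> rcases j with j | j <;> rfl⟩

def Iso.node {a b c d : PBT} (e : Iso a c) (f : Iso b d) : Iso (node a b) (node c d) :=
  ⟨Equiv.sumCongr e.1 f.1, fun i j => by
    rcases i with i | i <;> rcases j with j | j
    · exact e.2 i j
    · change PBT.dp _ (e.1 i) + PBT.dp _ (f.1 j) + 1 = _
      rw [e.dp, f.dp]; rfl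
    · change PBT.dp _ (f.1 i) + PBT.dp _ (e.1 j) + 1 = _
      rw [e.dp, f.dp]; rfl
    · exact f.2 i j⟩

theorem Iso.exists_node {a b c d : PBT} (e : Iso (PBT.node a b) (PBT.node c d)) (i₀ : L a)
    (h : PBT.side (e.1 (Sum.inl i₀)) = true) :
    ∃ (f : Iso a c) (g : Iso b d), Iso.node f g = e := by
  have hl : ∀ i : L a, ∃ k : L c, e.1 (Sum.inl i) = Sum.inl k := by
    intro i
    have h1 := (e.side (Sum.inl i) (Sum.inl i₀)).2 rfl
    rw [h] at h1
    rcases h2 : e.1 (Sum.inl i) with k | k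
    · exact ⟨k, rfl⟩
    · rw [h2] at h1; cases h1
  have hr : ∀ i : L b, ∃ k : L d, e.1 (Sum.inr i) = Sum.inr k := by
    intro i
    have h1 := (e.side (Sum.inr i) (Sum.inl i₀)).not.2 (by simp [PBT.side])
    rw [h] at h1
    rcases h2 : e.1 (Sum.inr i) with k | k
    · rw [h2] at h1; exact absurd rfl h1
    · exact ⟨k, rfl⟩
  choose f hf using hl
  choose g hg using hr
  have bf : Function.Bijective f := by
    constructor
    · intro x y hxy
      have : e.1 (Sum.inl x) = e.1 (Sum.inl y) := by rw [hf, hf, hxy]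
      exact Sum.inl.inj (e.1.injective this)
    · intro k
      obtain ⟨x, hx⟩ := e.1.surjective (Sum.inl k)
      rcases x with x | x
      · exact ⟨x, Sum.inl.inj ((hf x).symm.trans hx)⟩
      · cases (hg x).symm.trans hx
  have bg : Function.Bijective g := by
    constructor
    · intro x y hxy
      have : e.1 (Sum.inr x) = e.1 (Sum.inr y) := by rw [hg, hg, hxy]
      exact Sum.inr.inj (e.1.injective this)
    · intro k
      obtain ⟨x, hx⟩ := e.1.surjective (Sum.inr k)
      rcases x with x | x
      · cases (hf x).symm.trans hx
      · exact ⟨x, Sum.inr.inj ((hg x).symm.trans hx)⟩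
  refine ⟨⟨Equiv.ofBijective f bf, fun i j => ?_⟩, ⟨Equiv.ofBijective g bg, fun i j => ?_⟩, ?_⟩
  · have := e.2 (Sum.inl i) (Sum.inl j)
    rw [hf, hf] at this
    exact this
  · have := e.2 (Sum.inr i) (Sum.inr j)
    rw [hg, hg] at this
    exact this
  · apply Subtype.ext
    apply Equiv.ext
    rintro (x | x)
    · exact (hf x).symm
    · exact (hg x).symm

theorem Iso.node_inj {a b c d : PBT} {f f' : Iso a c} {g g' : Iso b d}
    (h : Iso.node f g = Iso.node f' g') : f = f' ∧ g = g' := by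
  have h1 : ∀ x, (Iso.node f g).1 x = (Iso.node f' g').1 x := fun x => by rw [h]
  constructor
  · apply Subtype.ext
    apply Equiv.ext
    intro x
    exact Sum.inl.inj (h1 (Sum.inl x))
  · apply Subtype.ext
    apply Equiv.ext
    intro x
    exact Sum.inr.inj (h1 (Sum.inr x))

/-- Assembling isometries. -/
def Iso.glue (a b c d : PBT) :
    (Iso a c × Iso b d) ⊕ (Iso a d × Iso b c) → Iso (PBT.node a b) (PBT.node c d)
  | Sum.inl p => Iso.node p.1 p.2
  | Sum.inr p => (Iso.node p.1 p.2).trans (Iso.swap d c)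

theorem Iso.trans_swap_swap {s a b : PBT} (e : Iso s (PBT.node a b)) :
    (e.trans (Iso.swap a b)).trans (Iso.swap b a) = e := by
  apply Subtype.ext
  apply Equiv.ext
  intro x
  change Sum.swap (Sum.swap (e.1 x)) = e.1 x
  exact Sum.swap_swap _

theorem Iso.glue_bij (a b c d : PBT) : Function.Bijective (Iso.glue a b c d) := by
  constructor
  · rintro (⟨f, g⟩ | ⟨f, g⟩) (⟨f', g'⟩ | ⟨f', g'⟩) h
    · obtain ⟨rfl, rfl⟩ := Iso.node_inj h; rfl
    · obtain ⟨i⟩ := nonemptyL a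
      have h1 : (Iso.glue a b c d (Sum.inl (f, g))).1 (Sum.inl i) =
        (Iso.glue a b c d (Sum.inr (f', g'))).1 (Sum.inl i) := by rw [h]
      cases h1
    · obtain ⟨i⟩ := nonemptyL a
      have h1 : (Iso.glue a b c d (Sum.inr (f, g))).1 (Sum.inl i) =
        (Iso.glue a b c d (Sum.inl (f', g'))).1 (Sum.inl i) := by rw [h]
      cases h1
    · have h1 : (Iso.node f g).trans (Iso.swap d c) = (Iso.node f' g').trans (Iso.swap d c) := h
      have h2 := congrArg (fun e => Iso.trans e (Iso.swap c d)) h1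
      simp only [Iso.trans_swap_swap] at h2
      obtain ⟨rfl, rfl⟩ := Iso.node_inj h2; rfl
  · intro e
    obtain ⟨i⟩ := nonemptyL a
    rcases h : e.1 (Sum.inl i) with k | k
    · obtain ⟨f, g, hfg⟩ := Iso.exists_node e i (by rw [h]; rfl)
      exact ⟨Sum.inl (f, g), hfg⟩
    · obtain ⟨f, g, hfg⟩ := Iso.exists_node (e.trans (Iso.swap c d)) i (by
        change PBT.side (Sum.swap (e.1 (Sum.inl i))) = true
        rw [h]; rfl)
      refine ⟨Sum.inr (f, g), ?_⟩
      change (Iso.node f g).trans (Iso.swap d c) = e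
      rw [hfg, Iso.trans_swap_swap]

instance (s t : PBT) : Finite (Iso s t) := by unfold Iso; infer_instance

/-- Number of isometries. -/
noncomputable def nI (s t : PBT) : ℕ := Nat.card (Iso s t)

theorem nI_node (a b c d : PBT) :
    nI (node a b) (node c d) = nI a c * nI b d + nI a d * nI b c := by
  unfold nI
  rw [← Nat.card_congr (Equiv.ofBijective _ (Iso.glue_bij a b c d)), Nat.card_sum, Nat.card_prod,
    Nat.card_prod]

theorem Iso.internals {s t : PBT} (e : Iso s t) : s.internals = t.internals := by
  have := Fintype.card_congr (((eL s).symm.trans e.1).trans (eL t))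
  simp only [Fintype.card_fin, nLeaves_eq] at this
  omega

theorem nI_pos_iff {s t : PBT} : 0 < nI s t ↔ Nonempty (Iso s t) := by
  unfold nI
  rw [Nat.card_pos_iff]
  exact ⟨fun h => h.1, fun h => ⟨h, inferInstance⟩⟩

theorem nI_ne {s t : PBT} (h : s.internals ≠ t.internals) : nI s t = 0 := by
  by_contra h1
  obtain ⟨e⟩ := nI_pos_iff.1 (Nat.pos_of_ne_zero h1)
  exact h e.internals

theorem nI_leaf : nI leaf leaf = 1 := by
  have : Subsingleton (Iso leaf leaf) := ⟨fun e f => by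
    apply Subtype.ext
    apply Equiv.ext
    intro x
    rfl⟩
  have h2 : 0 < nI leaf leaf := nI_pos_iff.2 ⟨Iso.refl _⟩
  have h3 : nI leaf leaf ≤ 1 := Finite.card_le_one_iff_subsingleton.2 this
  omega

theorem equiv_iff (s t : PBT) : PBTEquiv s t ↔ Nonempty (Iso s t) := by
  constructor
  · intro h
    induction h with
    | leaf => exact ⟨Iso.refl _⟩
    | node _ _ h1 h2 => exact ⟨Iso.node h1.some h2.some⟩
    | swap _ _ h1 h2 => exact ⟨(Iso.node h1.some h2.some).trans (Iso.swap _ _)⟩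
  · rintro ⟨e⟩
    induction s generalizing t with
    | leaf =>
      cases t with
      | leaf => exact .leaf
      | node c d => have := e.internals; simp [PBT.internals] at this
    | node a b iha ihb =>
      cases t with
      | leaf => have := e.internals; simp [PBT.internals] at this
      | node c d =>
        obtain ⟨x, hx⟩ := (Iso.glue_bij a b c d).2 e
        rcases x with ⟨f, g⟩ | ⟨f, g⟩
        · exact .node (iha _ f) (ihb _ g)
        · exact .swap (iha _ f) (ihb _ g)

theorem equivalence : Equivalence PBTEquiv where
  refl s := (equiv_iff _ _).2 ⟨Iso.refl s⟩
  symm h := (equiv_iff _ _).2 ⟨((equiv_iff _ _).1 h).some.symm⟩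
  trans h g := (equiv_iff _ _).2 ⟨((equiv_iff _ _).1 h).some.trans ((equiv_iff _ _).1 g).some⟩

theorem aut_eq (t : PBT) : pbtAut t = nI t t := by
  unfold pbtAut nI Iso
  refine Nat.card_congr (Equiv.subtypeEquiv (Equiv.equivCongr (eL t).symm (eL t).symm) ?_)
  intro σ
  constructor
  · intro h i j
    rw [← dist_eL, ← dist_eL]
    simpa using h (eL t i) (eL t j)
  · intro h i j
    have := h ((eL t).symm i) ((eL t).symm j)
    rw [← dist_eL, ← dist_eL] at this
    simpa using this

open Classical in
theorem nI_eq (s t : PBT) : nI s t = if PBTEquiv s t then nI t t else 0 := by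
  split_ifs with h
  · obtain ⟨e⟩ := (equiv_iff _ _).1 h
    refine Nat.card_congr ⟨fun f => e.symm.trans f, fun f => e.trans f, fun f => ?_, fun f => ?_⟩
    · apply Subtype.ext; apply Equiv.ext; intro x; simp [Iso.trans, Iso.symm]
    · apply Subtype.ext; apply Equiv.ext; intro x; simp [Iso.trans, Iso.symm]
  · by_contra h1
    exact h ((equiv_iff _ _).2 (nI_pos_iff.1 (Nat.pos_of_ne_zero h1)))

/-- Comparison with the Mathlib trees. -/
def ofTree : BinaryTree Unit → PBT
  | .nil => leaf
  | .node _ a b => node (ofTree a) (ofTree b)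

def toTree : PBT → BinaryTree Unit
  | leaf => .nil
  | node a b => .node () (toTree a) (toTree b)

theorem ofTree_toTree (t : PBT) : ofTree (toTree t) = t := by
  induction t with
  | leaf => rfl
  | node a b iha ihb => simp [toTree, ofTree, iha, ihb]

theorem toTree_ofTree (t : BinaryTree Unit) : toTree (ofTree t) = t := by
  induction t with
  | nil => rfl
  | node _ a b iha ihb => simp [toTree, ofTree, iha, ihb]

theorem numNodes_toTree (t : PBT) : (toTree t).numNodes = t.internals := by
  induction t with
  | leaf => rfl
  | node a b iha ihb => simp [toTree, BinaryTree.numNodes, internals, iha, ihb]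

theorem ofTree_inj : Function.Injective ofTree :=
  Function.LeftInverse.injective toTree_ofTree

/-- All trees with n internal vertices. -/
def F (n : ℕ) : Finset PBT := (BinaryTree.treesOfNumNodesEq n).map ⟨ofTree, ofTree_inj⟩

theorem mem_F {n : ℕ} {t : PBT} : t ∈ F n ↔ t.internals = n := by
  simp only [F, Finset.mem_map, BinaryTree.mem_treesOfNumNodesEq, Function.Embedding.coeFn_mk]
  constructor
  · rintro ⟨x, hx, rfl⟩
    rw [← numNodes_toTree, toTree_ofTree, hx]
  · intro h
    exact ⟨toTree t, by rw [numNodes_toTree, h], ofTree_toTree t⟩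

theorem card_F (n : ℕ) : (F n).card = catalan n := by
  rw [F, Finset.card_map, BinaryTree.treesOfNumNodesEq_card_eq_catalan]

theorem sum_F_succ (n : ℕ) (f : PBT → ℕ) :
    ∑ s ∈ F (n+1), f s = ∑ p ∈ Finset.HasAntidiagonal.antidiagonal n, ∑ a ∈ F p.1, ∑ b ∈ F p.2, f (node a b) := by
  simp_rw [← Finset.sum_product', Finset.sum_sigma']
  symm
  refine Finset.sum_bij (fun x _ => node x.2.1 x.2.2) ?_ ?_ ?_ ?_
  · rintro ⟨⟨i, j⟩, a, b⟩ h
    simp only [Finset.mem_sigma, Finset.HasAntidiagonal.mem_antidiagonal, Finset.mem_product, mem_F] at h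
    rw [mem_F, internals]; dsimp only; omega
  · rintro ⟨⟨i, j⟩, a, b⟩ h ⟨⟨i', j'⟩, a', b'⟩ h' he
    simp only [Finset.mem_sigma, Finset.HasAntidiagonal.mem_antidiagonal, Finset.mem_product, mem_F] at h h'
    obtain ⟨-, rfl, rfl⟩ := h
    obtain ⟨-, rfl, rfl⟩ := h'
    injection he with h1 h2
    subst h1 h2
    rfl
  · intro s hs
    rw [mem_F] at hs
    cases s with
    | leaf => simp [internals] at hs
    | node a b =>
      refine ⟨⟨(a.internals, b.internals), (a, b)⟩, ?_, rfl⟩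
      simp only [internals] at hs
      simp only [Finset.mem_sigma, Finset.HasAntidiagonal.mem_antidiagonal, Finset.mem_product, mem_F]
      exact ⟨by omega, trivial, trivial⟩
  · intros; rfl

theorem conv_F (a b : PBT)
    (iha : ∑ s ∈ F a.internals, nI s a = 2 ^ a.internals)
    (ihb : ∑ s ∈ F b.internals, nI s b = 2 ^ b.internals) (n : ℕ)
    (hn : a.internals + b.internals = n) :
    ∑ p ∈ Finset.HasAntidiagonal.antidiagonal n, ∑ c ∈ F p.1, ∑ d ∈ F p.2, nI c a * nI d b = 2 ^ n := by
  rw [Finset.sum_eq_single (a.internals, b.internals)]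
  · simp only [← Finset.mul_sum, ← Finset.sum_mul, iha, ihb]
    rw [← pow_add, hn]
  · rintro ⟨i, j⟩ h hne
    refine Finset.sum_eq_zero fun c hc => Finset.sum_eq_zero fun d hd => ?_
    rw [mem_F] at hc hd
    rw [Finset.HasAntidiagonal.mem_antidiagonal] at h
    simp only at h hc hd
    have : c.internals ≠ a.internals := by
      intro h1
      apply hne
      rw [Prod.mk.injEq]
      omega
    rw [nI_ne this, zero_mul]
  · intro h
    exact absurd (Finset.HasAntidiagonal.mem_antidiagonal.2 hn) h

theorem sum_nI (t : PBT) : ∑ s ∈ F t.internals, nI s t = 2 ^ t.internals := by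
  induction t with
  | leaf =>
    have : F (leaf.internals) = {leaf} := by
      ext s
      rw [mem_F, Finset.mem_singleton]
      cases s <;> simp [internals]
    rw [this, Finset.sum_singleton, nI_leaf]; rfl
  | node a b iha ihb =>
    rw [internals, sum_F_succ]
    simp_rw [nI_node, Finset.sum_add_distrib]
    rw [conv_F a b iha ihb _ rfl]
    have h := conv_F b a ihb iha _ (Nat.add_comm _ _)
    rw [h, pow_succ]; ring

open Classical in
theorem card_class (t : PBT) :
    ((F t.internals).filter (fun s => PBTEquiv s t)).card * pbtAut t = 2 ^ t.internals := by
  rw [← sum_nI, aut_eq, Finset.sum_congr rfl (fun s _ => nI_eq s t),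
    ← Finset.sum_filter, Finset.sum_const, smul_eq_mul]

/-- Class of a tree. -/
def cls (s : PBT) : PBTClass := Quot.mk PBTEquiv s

/-- Chosen representative. -/
noncomputable def rep (R : PBTClass) : PBT := Quot.out (r := PBTEquiv) R

theorem cls_rep (R : PBTClass) : cls (rep R) = R := Quot.out_eq (r := PBTEquiv) R

theorem cls_eq_iff (s t : PBT) : cls s = cls t ↔ PBTEquiv s t := equivalence.quot_mk_eq_iff s t

open Classical in
theorem main_sum (n : ℕ) : (∑ᶠ R : PBTClass,
    if (Quot.out R).internals = n then (2 : ℚ) ^ n / (pbtAut (Quot.out R) : ℚ) else 0) =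
      (catalan n : ℚ) := by
  have hmk : ∀ s (R : PBTClass), cls s = R ↔ PBTEquiv s (rep R) := by
    intro s R
    rw [← cls_eq_iff, cls_rep]
  change (∑ᶠ R : PBTClass,
    if (rep R).internals = n then (2 : ℚ) ^ n / (pbtAut (rep R) : ℚ) else 0) = (catalan n : ℚ)
  rw [finsum_eq_sum_of_support_subset
    (s := (F n).image cls)]
  · rw [← card_F, Finset.card_eq_sum_card_image cls,
      Nat.cast_sum]
    refine Finset.sum_congr rfl fun R hR => ?_
    obtain ⟨s, hs, hsR⟩ := Finset.mem_image.1 hR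
    rw [mem_F] at hs
    have hi : (rep R).internals = n := by
      obtain ⟨e⟩ := (equiv_iff _ _).1 ((hmk s R).1 hsR)
      rw [← e.internals, hs]
    rw [if_pos hi]
    have h := card_class (rep R)
    rw [hi] at h
    have hpos : pbtAut (rep R) ≠ 0 := by
      intro h0
      rw [h0, mul_zero] at h
      exact absurd h.symm (by positivity)
    rw [div_eq_iff (by exact_mod_cast hpos)]
    simp_rw [hmk]
    exact_mod_cast h.symm
  · intro R hR
    rw [Function.mem_support] at hR
    have hi : (rep R).internals = n := by
      by_contra h
      exact hR (if_neg h)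
    rw [Finset.mem_coe, Finset.mem_image]
    exact ⟨rep R, mem_F.2 hi, cls_rep R⟩

theorem coeff_eq (n : ℕ) : pbtCoeff n = (catalan n : ℚ) / 2 ^ n := by
  rw [← main_sum, div_eq_inv_mul, ← smul_eq_mul, smul_finsum, pbtCoeff]
  refine finsum_congr fun R => ?_
  rw [smul_eq_mul]
  split_ifs
  · field_simp
  · simp

theorem series_eq : PowerSeries.X * pbtO ^ 2 = 2 * pbtO - 2 := by
  have h2 : (2 : PowerSeries ℚ) = PowerSeries.C (2 : ℚ) := (map_ofNat PowerSeries.C 2).symm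
  ext n
  rw [h2, map_sub, PowerSeries.coeff_C_mul, PowerSeries.coeff_C]
  cases n with
  | zero => simp [pbtO, coeff_eq]
  | succ n =>
    rw [PowerSeries.coeff_succ_X_mul, pow_two, PowerSeries.coeff_mul]
    simp only [pbtO, PowerSeries.coeff_mk, coeff_eq]
    rw [catalan_succ', if_neg (by omega), sub_zero, Nat.cast_sum, Finset.sum_div, Finset.mul_sum]
    refine Finset.sum_congr rfl fun p hp => ?_
    rw [Finset.HasAntidiagonal.mem_antidiagonal] at hp
    rw [← hp]
    push_cast
    field_simp
    ring

end PBT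

open Classical in
/-- The object generating function of the updown category of binary rooted trees is
`Σ_{n≥0} (C_n/2^n) t^n = (1 − √(1 − 2t))/t` (where `O = (1−√(1−2t))/t` is expressed
by the equivalent algebraic identity `t·O² = 2·O − 2`); equivalently, for each `n`,
the sum over isomorphism classes `R` of binary rooted trees with `n` internal
vertices of `2^n/|Aut(R)|` equals the Catalan number `C_n`. -/
theorem binary_tree_generating_function :
    (∀ n : ℕ, pbtCoeff n = (catalan n : ℚ) / 2 ^ n) ∧
    PowerSeries.X * pbtO ^ 2 = 2 * pbtO - 2 ∧
    (∀ n : ℕ, (∑ᶠ R : PBTClass,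
        if (Quot.out R).internals = n then (2 : ℚ) ^ n / (pbtAut (Quot.out R) : ℚ) else 0) =
      (catalan n : ℚ)) := by
  exact ⟨PBT.coeff_eq, PBT.series_eq, PBT.main_sum⟩
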